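/- arXiv:2012.10650 — 5 statements merged into one kernel-verified Lean document; each statement's English description precedes it below -/
import Mathlib

section
/- Let H be a real inner product space, λ > 0, T a positive integer, and f : H → ℝ a λ-strongly convex function, i.e. the map x ↦ f(x) − (λ/2)‖x‖² is convex. Let w* ∈ H be a minimizer of f. Suppose (w_t)_{t=1}^T is a sequence in H with w_1 ∈ H arbitrary and, for each t, w_{t+1} = w_t − (1/(λt)) g_t, where g_t is a subgradient of f at w_t (i.e. f(y) ≥ f(w_t) + ⟨g_t, y − w_t⟩ for all y ∈ H) with ‖g_t‖² ≤ M. Then (1/T) Σ_{t=1}^T f(w_t) ≤ f(w*) + M(1 + ln T)/(2λT); in particular min_{1 ≤ t ≤ T} f(w_t) ≤ f(w*) + M(1 + ln T)/(2λT). -/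
open scoped RealInnerProductSpace

theorem strong_sub {H : Type*} [NormedAddCommGroup H] [InnerProductSpace ℝ H]
    (lam : ℝ) (hlam : 0 < lam) (f : H → ℝ)
    (hconv : ConvexOn ℝ Set.univ (fun x : H => f x - lam / 2 * ‖x‖ ^ 2))
    (x g : H) (hs : ∀ y : H, f x + ⟪g, y - x⟫ ≤ f y) (y : H) :
    f x + ⟪g, y - x⟫ + lam / 2 * ‖y - x‖ ^ 2 ≤ f y := by
  have h2 := (strongConvexOn_iff_convex.2 hconv).2
  have key : ∀ s : ℝ, 0 < s → s < 1 →
      f x + ⟪g, y - x⟫ + lam / 2 * ‖y - x‖ ^ 2 - f y ≤ s * (lam / 2 * ‖y - x‖ ^ 2) := by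
    intro s h0 h1
    have a := h2 (Set.mem_univ y) (Set.mem_univ x) h0.le (sub_nonneg.2 h1.le) (by ring)
    have b := hs (s • y + (1 - s) • x)
    have e : s • y + (1 - s) • x - x = s • (y - x) := by module
    rw [e, inner_smul_right] at b
    simp only [smul_eq_mul] at a
    refine le_of_mul_le_mul_left ?_ h0
    linarith
  have hc : 0 ≤ lam / 2 * ‖y - x‖ ^ 2 := by positivity
  generalize lam / 2 * ‖y - x‖ ^ 2 = c at *
  by_contra! hA
  obtain ⟨A, hAe⟩ : ∃ A, A = f x + ⟪g, y - x⟫ + c - f y := ⟨_, rfl⟩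
  rw [← hAe] at key
  have hA0 : 0 < A := by linarith
  have k := key (A / (2 * c + 2 * A)) (by positivity) (by rw [div_lt_one (by positivity)]; linarith)
  rw [div_mul_eq_mul_div, le_div_iff₀ (by positivity)] at k
  nlinarith [mul_nonneg hA0.le hc, mul_pos hA0 hA0]

/-- Logarithmic-regret convergence bound for subgradient descent with step size
`η_t = 1/(λ t)` on a `λ`-strongly convex function. -/
theorem stmt_0 {H : Type*} [NormedAddCommGroup H] [InnerProductSpace ℝ H]
    (lam : ℝ) (hlam : 0 < lam) (T : ℕ) (hT : 0 < T)
    (f : H → ℝ) (M : ℝ)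
    (hconv : ConvexOn ℝ Set.univ (fun x : H => f x - lam / 2 * ‖x‖ ^ 2))
    (wstar : H) (hmin : ∀ y : H, f wstar ≤ f y)
    (w g : ℕ → H)
    (hsub : ∀ t, 1 ≤ t → ∀ y : H, f (w t) + ⟪g t, y - w t⟫ ≤ f y)
    (hg : ∀ t, 1 ≤ t → ‖g t‖ ^ 2 ≤ M)
    (hupd : ∀ t, 1 ≤ t → w (t + 1) = w t - (1 / (lam * (t : ℝ))) • g t) :
    (1 / (T : ℝ)) * ∑ t ∈ Finset.Icc 1 T, f (w t)
        ≤ f wstar + M * (1 + Real.log T) / (2 * lam * T) ∧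
      ∃ t ∈ Finset.Icc 1 T, f (w t) ≤ f wstar + M * (1 + Real.log T) / (2 * lam * T) := by
  have main : ∀ n : ℕ, ∑ t ∈ Finset.Icc 1 n, f (w t) ≤ n * f wstar
      + M / (2 * lam) * ((harmonic n : ℚ) : ℝ) - lam * n / 2 * ‖w (n + 1) - wstar‖ ^ 2 := by
    intro n
    induction n with
    | zero => simp
    | succ n ih =>
      rw [Finset.sum_Icc_succ_top (by omega), harmonic_succ]
      have hs := strong_sub lam hlam f hconv _ _ (hsub (n + 1) (by omega)) wstar
      have hgn := hg (n + 1) (by omega)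
      have hu := hupd (n + 1) (by omega)
      have e : w (n + 1 + 1) - wstar
          = (w (n + 1) - wstar) - (1 / (lam * ((n + 1 : ℕ) : ℝ))) • g (n + 1) := by
        rw [hu]; abel
      have hD := norm_sub_sq_real (w (n + 1) - wstar) ((1 / (lam * ((n + 1 : ℕ) : ℝ))) • g (n + 1))
      rw [← e, inner_smul_right, norm_smul, mul_pow, Real.norm_eq_abs, sq_abs,
        real_inner_comm] at hD
      have e2 : ⟪g (n + 1), wstar - w (n + 1)⟫ = - ⟪g (n + 1), w (n + 1) - wstar⟫ := by
        rw [← inner_neg_right, neg_sub]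
      rw [e2, norm_sub_rev] at hs
      rw [hD]
      push_cast
      have hn : (0 : ℝ) < (n : ℝ) + 1 := by positivity
      generalize ⟪g (n + 1), w (n + 1) - wstar⟫ = I at *
      generalize ‖w (n + 1) - wstar‖ ^ 2 = D at *
      generalize ‖g (n + 1)‖ ^ 2 = G at *
      have e3 : lam * ((n : ℝ) + 1) / 2 * (D - 2 * (1 / (lam * ((n : ℝ) + 1)) * I)
          + (1 / (lam * ((n : ℝ) + 1))) ^ 2 * G)
          = lam * (n + 1) / 2 * D - I + 1 / (2 * lam) * ((n : ℝ) + 1)⁻¹ * G := by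
        field_simp
      have e4 : 1 / (2 * lam) * ((n : ℝ) + 1)⁻¹ * G ≤ 1 / (2 * lam) * ((n : ℝ) + 1)⁻¹ * M := by
        gcongr
      rw [e3]
      have e5 : M / (2 * lam) = 1 / (2 * lam) * M := by ring
      rw [e5] at ih ⊢
      linarith
  have hT' : (0 : ℝ) < T := by exact_mod_cast hT
  have hM : 0 ≤ M := le_trans (by positivity) (hg 1 le_rfl)
  have fin : ∑ t ∈ Finset.Icc 1 T, f (w t)
      ≤ T * (f wstar + M * (1 + Real.log T) / (2 * lam * T)) := by
    have h1 := main T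
    have h2 : M / (2 * lam) * ((harmonic T : ℚ) : ℝ) ≤ M / (2 * lam) * (1 + Real.log T) := by
      gcongr
      exact harmonic_le_one_add_log T
    have h3 : 0 ≤ lam * T / 2 * ‖w (T + 1) - wstar‖ ^ 2 := by positivity
    have h4 : T * (f wstar + M * (1 + Real.log T) / (2 * lam * T))
        = T * f wstar + M / (2 * lam) * (1 + Real.log T) := by
      field_simp
    linarith
  constructor
  · rw [one_div, inv_mul_le_iff₀ hT']
    exact fin
  · by_contra! hcon
    have := Finset.sum_lt_sum_of_nonempty (Finset.nonempty_Icc.2 hT) hcon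
    simp only [Finset.sum_const, Nat.card_Icc, nsmul_eq_mul, Nat.add_sub_cancel] at this
    linarith
end

section
/- Let H be a real inner product space, λ > 0, σ > 0, and f : H → ℝ a λ-strongly convex function (i.e. x ↦ f(x) − (λ/2)‖x‖² is convex) with minimizer w* ∈ H. Suppose (w_t) is generated by w_{t+1} = w_t − (1/(λt)) g_t with g_t a subgradient of f at w_t and ‖g_t‖² ≤ M for all t. If the positive integer T satisfies M(1 + ln T) ≤ 2λTσ, then min_{1 ≤ t ≤ T} f(w_t) ≤ f(w*) + σ, i.e. the subgradient descent step achieves a solution within σ of optimal. -/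
open scoped RealInnerProductSpace

theorem strong_subgrad {H : Type*} [NormedAddCommGroup H] [InnerProductSpace ℝ H]
    (lam : ℝ) (f : H → ℝ)
    (hconv : ConvexOn ℝ Set.univ (fun x : H => f x - lam / 2 * ‖x‖ ^ 2))
    (w g : H) (hsub : ∀ y : H, f w + ⟪g, y - w⟫ ≤ f y) (y : H) :
    f w + ⟪g, y - w⟫ + lam / 2 * ‖y - w‖ ^ 2 ≤ f y := by
  have key : ∀ s : ℝ, 0 < s → s < 1 →
      f w + ⟪g, y - w⟫ + lam / 2 * (1 - s) * ‖y - w‖ ^ 2 ≤ f y := by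
    intro s hs0 hs1
    have h1 := hconv.2 (Set.mem_univ w) (Set.mem_univ y) (by linarith : 0 ≤ 1 - s) hs0.le (by ring)
    have h2 := hsub ((1 - s) • w + s • y)
    have e1 : (1 - s) • w + s • y - w = s • (y - w) := by module
    rw [e1, inner_smul_right] at h2
    have e2 : ‖(1 - s) • w + s • y‖ ^ 2
        = (1 - s) * ‖w‖ ^ 2 + s * ‖y‖ ^ 2 - s * (1 - s) * ‖y - w‖ ^ 2 := by
      rw [norm_add_sq_real, norm_sub_sq_real, norm_smul, norm_smul, mul_pow, mul_pow,
        inner_smul_left, inner_smul_right, real_inner_comm]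
      simp only [Real.norm_eq_abs, sq_abs, conj_trivial]
      ring
    simp only [smul_eq_mul] at h1
    rw [e2] at h1
    have h3 : s * (f w + ⟪g, y - w⟫ + lam / 2 * (1 - s) * ‖y - w‖ ^ 2) ≤ s * f y := by
      linarith
    exact le_of_mul_le_mul_left h3 hs0
  have hc : Filter.Tendsto
      (fun s : ℝ => f w + ⟪g, y - w⟫ + lam / 2 * (1 - s) * ‖y - w‖ ^ 2)
      (nhdsWithin 0 (Set.Ioi 0))
      (nhds (f w + ⟪g, y - w⟫ + lam / 2 * (1 - 0) * ‖y - w‖ ^ 2)) := by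
    apply Filter.Tendsto.mono_left _ nhdsWithin_le_nhds
    apply Continuous.tendsto
    fun_prop
  rw [sub_zero, mul_one] at hc
  refine le_of_tendsto hc ?_
  filter_upwards [Ioo_mem_nhdsGT (zero_lt_one' ℝ)] with s hs
  exact key s hs.1 hs.2

/-- Subgradient descent with step size `η_t = 1/(λ t)` on a `λ`-strongly convex function
achieves a solution within `σ` of optimal once `M (1 + ln T) ≤ 2 λ T σ`. -/
theorem stmt_1 {H : Type*} [NormedAddCommGroup H] [InnerProductSpace ℝ H]
    (lam σ : ℝ) (hlam : 0 < lam) (hσ : 0 < σ)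
    (f : H → ℝ) (M : ℝ)
    (hconv : ConvexOn ℝ Set.univ (fun x : H => f x - lam / 2 * ‖x‖ ^ 2))
    (wstar : H) (hmin : ∀ y : H, f wstar ≤ f y)
    (w g : ℕ → H)
    (hsub : ∀ t, 1 ≤ t → ∀ y : H, f (w t) + ⟪g t, y - w t⟫ ≤ f y)
    (hg : ∀ t, 1 ≤ t → ‖g t‖ ^ 2 ≤ M)
    (hupd : ∀ t, 1 ≤ t → w (t + 1) = w t - (1 / (lam * (t : ℝ))) • g t)
    (T : ℕ) (hT : 0 < T)
    (hTσ : M * (1 + Real.log T) ≤ 2 * lam * T * σ) :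
    ∃ t ∈ Finset.Icc 1 T, f (w t) ≤ f wstar + σ := by
  obtain ⟨t0, ht0, hm⟩ := Finset.exists_min_image (Finset.Icc 1 T) (fun t => f (w t))
    ⟨1, by simp; omega⟩
  refine ⟨t0, ht0, ?_⟩
  have hM : 0 ≤ M := le_trans (sq_nonneg _) (hg 1 le_rfl)
  have main : ∀ n : ℕ, n ≤ T → 2 * n * (f (w t0) - f wstar)
      + lam * n * ‖w (n + 1) - wstar‖ ^ 2 ≤ M / lam * (harmonic n : ℝ) := by
    intro n
    induction n with
    | zero => intro _; simp
    | succ n ih =>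
      intro hn
      have ih := ih (by omega)
      have h1 := strong_subgrad lam f hconv (w (n + 1)) (g (n + 1)) (hsub _ (by omega)) wstar
      have h2 := hm (n + 1) (by simp; omega)
      have h3 := hg (n + 1) (by omega)
      have h4 := hupd (n + 1) (by omega)
      have hp : (0 : ℝ) < ((n + 1 : ℕ) : ℝ) := by positivity
      have e : w (n + 1 + 1) - wstar
          = (w (n + 1) - wstar) - (1 / (lam * ((n + 1 : ℕ) : ℝ))) • g (n + 1) := by
        rw [h4]; abel
      have e2 : ⟪g (n + 1), wstar - w (n + 1)⟫ = - ⟪w (n + 1) - wstar, g (n + 1)⟫ := by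
        rw [← neg_sub, inner_neg_right, real_inner_comm]
      rw [e2, norm_sub_rev] at h1
      rw [e, norm_sub_sq_real, norm_smul, mul_pow, inner_smul_right, harmonic_succ]
      simp only [Real.norm_eq_abs, sq_abs]
      have hc : ((n + 1 : ℕ) : ℝ) = n + 1 := by push_cast; ring
      push_cast at *
      set p : ℝ := (n : ℝ) + 1 with hpdef
      have hnp : (n : ℝ) = p - 1 := by rw [hpdef]; ring
      rw [hnp] at ih
      have e3 : ∀ D I G : ℝ, lam * p * (D - 2 * (1 / (lam * p) * I) + (1 / (lam * p)) ^ 2 * G)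
          = lam * p * D - 2 * I + G * (1 / (lam * p)) := by
        intro D I G; field_simp
      rw [e3]
      have h5 := mul_le_mul_of_nonneg_right h3 (by positivity : 0 ≤ 1 / (lam * p))
      have e4 : M / lam * ((harmonic n : ℝ) + p⁻¹)
          = M / lam * (harmonic n : ℝ) + M * (1 / (lam * p)) := by field_simp
      rw [e4]
      linarith
  have h := main T le_rfl
  have hl := mul_le_mul_of_nonneg_left (harmonic_le_one_add_log T) (div_nonneg hM hlam.le)
  have hTp : (0 : ℝ) < T := by exact_mod_cast hT
  have h6 : M / lam * (1 + Real.log T) ≤ 2 * T * σ := by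
    rw [div_mul_eq_mul_div, div_le_iff₀ hlam]; linarith
  have h7 : 0 ≤ lam * T * ‖w (T + 1) - wstar‖ ^ 2 := by positivity
  have h8 : (2 * (T : ℝ)) * (f (w t0) - f wstar) ≤ (2 * T) * σ := by linarith
  have h9 := le_of_mul_le_mul_left h8 (by positivity)
  linarith
end

section
/- For every W ∈ H^C, the vector ∇(W) = (∇_1(W),…,∇_C(W)) ∈ H^C with ∇_c(W) = λ w_c + v_c(W) is a subgradient of L at W; that is, for all W' = (w'_1,…,w'_C) ∈ H^C, L(W') ≥ L(W) + Σ_{c=1}^C ⟨∇_c(W), w'_c − w_c⟩. -/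
open scoped RealInnerProductSpace
open Finset

/-- The regularized surrogate loss `L` (Eq. 5 of the paper). -/
noncomputable def surrogateLoss {H : Type*} [NormedAddCommGroup H] [InnerProductSpace ℝ H]
    {n C : ℕ} (lam : ℝ) (Yp : Fin n → Finset (Fin C)) (x : Fin n → Fin C → H)
    (W : Fin C → H) : ℝ :=
  lam / 2 * ∑ c, ‖W c‖ ^ 2 +
    (1 / (n : ℝ)) * ∑ i, (
      (1 / ((Yp i).card : ℝ) ^ 2) * ∑ p ∈ Yp i, max 0 (1 - ⟪W p, x i p⟫) +
      (1 / (((Yp i)ᶜ).card : ℝ) ^ 2) * ∑ q ∈ (Yp i)ᶜ, max 0 (1 + ⟪W q, x i q⟫) +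
      (1 / (((Yp i).card : ℝ) * (((Yp i)ᶜ).card : ℝ))) *
        ∑ p ∈ Yp i, ∑ q ∈ (Yp i)ᶜ, max 0 (2 + ⟪W q, x i q⟫ - ⟪W p, x i p⟫))

open scoped Classical in
/-- The coefficient `β_{i,c}(W)` of `x_{i,c}` in the non-regularization part of
the subgradient of `L` at `W`. -/
noncomputable def betaCoeff {H : Type*} [NormedAddCommGroup H] [InnerProductSpace ℝ H]
    {n C : ℕ} (Yp : Fin n → Finset (Fin C)) (x : Fin n → Fin C → H)
    (W : Fin C → H) (i : Fin n) (c : Fin C) : ℝ :=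
  -(1 / ((Yp i).card : ℝ) ^ 2) * (if c ∈ Yp i then 1 else 0) *
      (if ⟪W c, x i c⟫ ≤ 1 then 1 else 0)
  + (1 / (((Yp i)ᶜ).card : ℝ) ^ 2) * (if c ∈ (Yp i)ᶜ then 1 else 0) *
      (if (-1 : ℝ) ≤ ⟪W c, x i c⟫ then 1 else 0)
  + (1 / (((Yp i).card : ℝ) * (((Yp i)ᶜ).card : ℝ))) *
      ((if c ∈ (Yp i)ᶜ then 1 else 0) *
          ∑ p ∈ Yp i, (if ⟪W p, x i p⟫ ≤ 2 + ⟪W c, x i c⟫ then (1 : ℝ) else 0)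
        - (if c ∈ Yp i then 1 else 0) *
          ∑ q ∈ (Yp i)ᶜ, (if ⟪W c, x i c⟫ ≤ 2 + ⟪W q, x i q⟫ then (1 : ℝ) else 0))

/-- The non-regularization part `v_c(W)` of the subgradient of `L` at `W`. -/
noncomputable def vPart {H : Type*} [NormedAddCommGroup H] [InnerProductSpace ℝ H]
    {n C : ℕ} (Yp : Fin n → Finset (Fin C)) (x : Fin n → Fin C → H)
    (W : Fin C → H) (c : Fin C) : H :=
  (1 / (n : ℝ)) • ∑ i, betaCoeff Yp x W i c • x i c

theorem hinge_aux (a b : ℝ) (P : Prop) [Decidable P] (hP : P ↔ 0 ≤ a) :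
    max 0 a + (if P then 1 else 0) * (b - a) ≤ max 0 b := by
  split_ifs with h
  · rw [max_eq_right (hP.1 h)]
    linarith [le_max_right 0 b]
  · have : a < 0 := by
      by_contra h'
      exact h (hP.2 (not_lt.1 h'))
    rw [max_eq_left this.le]
    linarith [le_max_left 0 b]

open scoped Classical in
theorem sample_aux {C : ℕ} (S T : Finset (Fin C)) (A B D : ℝ) (hA : 0 ≤ A) (hB : 0 ≤ B)
    (hD : 0 ≤ D) (s t : Fin C → ℝ) :
    (A * ∑ p ∈ S, max 0 (1 - s p) + B * ∑ q ∈ T, max 0 (1 + s q)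
      + D * ∑ p ∈ S, ∑ q ∈ T, max 0 (2 + s q - s p))
    + ∑ c, (-A * (if c ∈ S then 1 else 0) * (if s c ≤ 1 then 1 else 0)
        + B * (if c ∈ T then 1 else 0) * (if (-1 : ℝ) ≤ s c then 1 else 0)
        + D * ((if c ∈ T then 1 else 0) * ∑ p ∈ S, (if s p ≤ 2 + s c then (1 : ℝ) else 0)
          - (if c ∈ S then 1 else 0) * ∑ q ∈ T, (if s c ≤ 2 + s q then (1 : ℝ) else 0)))
        * (t c - s c)
    ≤ A * ∑ p ∈ S, max 0 (1 - t p) + B * ∑ q ∈ T, max 0 (1 + t q)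
      + D * ∑ p ∈ S, ∑ q ∈ T, max 0 (2 + t q - t p) := by
  have key : ∀ (U : Finset (Fin C)) (f : Fin C → ℝ),
      ∑ c, (if c ∈ U then (1 : ℝ) else 0) * f c = ∑ c ∈ U, f c := by
    intro U f
    simp [ite_mul, Finset.sum_ite_mem]
  have e : ∑ c, (-A * (if c ∈ S then 1 else 0) * (if s c ≤ 1 then 1 else 0)
        + B * (if c ∈ T then 1 else 0) * (if (-1 : ℝ) ≤ s c then 1 else 0)
        + D * ((if c ∈ T then 1 else 0) * ∑ p ∈ S, (if s p ≤ 2 + s c then (1 : ℝ) else 0)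
          - (if c ∈ S then 1 else 0) * ∑ q ∈ T, (if s c ≤ 2 + s q then (1 : ℝ) else 0)))
        * (t c - s c)
      = A * ∑ p ∈ S, (if s p ≤ 1 then 1 else 0) * ((1 - t p) - (1 - s p))
      + B * ∑ q ∈ T, (if (-1 : ℝ) ≤ s q then 1 else 0) * ((1 + t q) - (1 + s q))
      + D * ∑ p ∈ S, ∑ q ∈ T, (if s p ≤ 2 + s q then (1 : ℝ) else 0) *
          ((2 + t q - t p) - (2 + s q - s p)) := by
    have e3 : ∑ p ∈ S, ∑ q ∈ T, (if s p ≤ 2 + s q then (1 : ℝ) else 0) *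
          ((2 + t q - t p) - (2 + s q - s p))
        = ∑ q ∈ T, (∑ p ∈ S, (if s p ≤ 2 + s q then (1 : ℝ) else 0)) * (t q - s q)
        - ∑ p ∈ S, (∑ q ∈ T, (if s p ≤ 2 + s q then (1 : ℝ) else 0)) * (t p - s p) := by
      simp only [Finset.sum_mul]
      rw [Finset.sum_comm (s := T), ← Finset.sum_sub_distrib]
      refine Finset.sum_congr rfl fun p _ => ?_
      rw [← Finset.sum_sub_distrib]
      refine Finset.sum_congr rfl fun q _ => ?_
      ring
    rw [e3, ← key S, ← key T, ← key T, ← key S, ← Finset.sum_sub_distrib, Finset.mul_sum,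
      Finset.mul_sum, Finset.mul_sum, ← Finset.sum_add_distrib, ← Finset.sum_add_distrib]
    refine Finset.sum_congr rfl fun c _ => ?_
    ring
  have h1 : ∑ p ∈ S, max 0 (1 - s p)
      + ∑ p ∈ S, (if s p ≤ 1 then 1 else 0) * ((1 - t p) - (1 - s p))
      ≤ ∑ p ∈ S, max 0 (1 - t p) := by
    rw [← Finset.sum_add_distrib]
    exact Finset.sum_le_sum fun p _ => hinge_aux _ _ _ (by constructor <;> intro h <;> linarith)
  have h2 : ∑ q ∈ T, max 0 (1 + s q)
      + ∑ q ∈ T, (if (-1 : ℝ) ≤ s q then 1 else 0) * ((1 + t q) - (1 + s q))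
      ≤ ∑ q ∈ T, max 0 (1 + t q) := by
    rw [← Finset.sum_add_distrib]
    exact Finset.sum_le_sum fun p _ => hinge_aux _ _ _ (by constructor <;> intro h <;> linarith)
  have h3 : ∑ p ∈ S, ∑ q ∈ T, max 0 (2 + s q - s p)
      + ∑ p ∈ S, ∑ q ∈ T, (if s p ≤ 2 + s q then (1 : ℝ) else 0) *
          ((2 + t q - t p) - (2 + s q - s p))
      ≤ ∑ p ∈ S, ∑ q ∈ T, max 0 (2 + t q - t p) := by
    rw [← Finset.sum_add_distrib]
    refine Finset.sum_le_sum fun p _ => ?_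
    rw [← Finset.sum_add_distrib]
    exact Finset.sum_le_sum fun p _ => hinge_aux _ _ _ (by constructor <;> intro h <;> linarith)
  rw [e]
  linarith [mul_le_mul_of_nonneg_left h1 hA, mul_le_mul_of_nonneg_left h2 hB,
    mul_le_mul_of_nonneg_left h3 hD]

/-- `∇(W) = (λ w_1 + v_1(W), …, λ w_C + v_C(W))` is a subgradient of `L` at `W`. -/
theorem stmt_3 {H : Type*} [NormedAddCommGroup H] [InnerProductSpace ℝ H]
    (n C : ℕ) (hn : 0 < n) (hC : 0 < C)
    (lam : ℝ) (hlam : 0 < lam)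
    (Yp : Fin n → Finset (Fin C))
    (hpos : ∀ i, (Yp i).Nonempty) (hneg : ∀ i, ((Yp i)ᶜ).Nonempty)
    (x : Fin n → Fin C → H) (W : Fin C → H) :
    ∀ W' : Fin C → H,
      surrogateLoss lam Yp x W
          + ∑ c, ⟪lam • W c + vPart Yp x W c, W' c - W c⟫
        ≤ surrogateLoss lam Yp x W' := by
  intro W'
  have hreg : lam / 2 * ∑ c, ‖W c‖ ^ 2 + ∑ c, ⟪lam • W c, W' c - W c⟫
      ≤ lam / 2 * ∑ c, ‖W' c‖ ^ 2 := by
    rw [Finset.mul_sum, Finset.mul_sum, ← Finset.sum_add_distrib]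
    refine Finset.sum_le_sum fun c _ => ?_
    have h0 : ‖W' c - W c‖ ^ 2 = ‖W' c‖ ^ 2 - 2 * ⟪W' c, W c⟫ + ‖W c‖ ^ 2 :=
      norm_sub_sq_real _ _
    rw [real_inner_smul_left, inner_sub_right, real_inner_self_eq_norm_sq,
      real_inner_comm (W' c) (W c)]
    nlinarith [mul_nonneg hlam.le (sq_nonneg ‖W' c - W c‖)]
  have hv : ∑ c, ⟪vPart Yp x W c, W' c - W c⟫
      = (1 / (n : ℝ)) * ∑ i, ∑ c, betaCoeff Yp x W i c * (⟪W' c, x i c⟫ - ⟪W c, x i c⟫) := by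
    rw [Finset.sum_comm, Finset.mul_sum]
    refine Finset.sum_congr rfl fun c _ => ?_
    rw [vPart, real_inner_smul_left, sum_inner]
    congr 1
    refine Finset.sum_congr rfl fun i _ => ?_
    rw [real_inner_smul_left, ← inner_sub_left, real_inner_comm]
  have hs := Finset.sum_le_sum (s := Finset.univ) fun (i : Fin n) _ =>
    sample_aux (Yp i) (Yp i)ᶜ (1 / ((Yp i).card : ℝ) ^ 2) (1 / (((Yp i)ᶜ).card : ℝ) ^ 2)
      (1 / (((Yp i).card : ℝ) * (((Yp i)ᶜ).card : ℝ))) (by positivity) (by positivity)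
      (by positivity) (fun c => ⟪W c, x i c⟫) (fun c => ⟪W' c, x i c⟫)
  have hs' := mul_le_mul_of_nonneg_left hs (show (0 : ℝ) ≤ 1 / (n : ℝ) by positivity)
  rw [Finset.sum_add_distrib, mul_add] at hs'
  simp only [inner_add_left, Finset.sum_add_distrib (f := fun c => ⟪lam • W c, W' c - W c⟫)]
  rw [hv]
  simp only [surrogateLoss, betaCoeff]
  linarith
end

section
/- If K ≥ 0 and ‖x_{i,c}‖ ≤ K for all i ∈ {1,…,n} and c ∈ {1,…,C}, then for every W ∈ H^C and every c ∈ {1,…,C}, the non-regularization part of the subgradient satisfies ‖v_c(W)‖ ≤ 2K. (Indeed, the coefficient of x_{i,c} satisfies |β_{i,c}(W)| ≤ 1/|Y_i⁺|² + 1/|Y_i⁺| ≤ 2 when c ∈ Y_i⁺ and |β_{i,c}(W)| ≤ 1/|Y_i⁻|² + 1/|Y_i⁻| ≤ 2 when c ∈ Y_i⁻.) -/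
open scoped RealInnerProductSpace
open Finset

theorem sum_ind_bound {α : Type*} (s : Finset α) (P : α → Prop) [DecidablePred P] :
    0 ≤ ∑ p ∈ s, (if P p then (1 : ℝ) else 0) ∧
      ∑ p ∈ s, (if P p then (1 : ℝ) else 0) ≤ (s.card : ℝ) := by
  constructor
  · exact Finset.sum_nonneg fun p _ => by split_ifs <;> norm_num
  · calc _ ≤ ∑ p ∈ s, (1 : ℝ) := Finset.sum_le_sum fun p _ => by split_ifs <;> norm_num
      _ = _ := by simp

theorem coef_bound (a b s e : ℝ) (ha : 1 ≤ a) (hb : 1 ≤ b) (hs : 0 ≤ s) (hsa : s ≤ a)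
    (he : 0 ≤ e) (he1 : e ≤ 1) :
    0 ≤ 1 / b ^ 2 * e + 1 / (a * b) * s ∧ 1 / b ^ 2 * e + 1 / (a * b) * s ≤ 2 := by
  refine ⟨by positivity, ?_⟩
  have h1 : 1 / b ^ 2 ≤ 1 := by
    rw [div_le_one (by positivity)]; nlinarith
  have h2 : 1 / b ^ 2 * e ≤ 1 := mul_le_one₀ h1 he he1
  have h3 : 1 / (a * b) * s ≤ 1 := by
    rw [one_div_mul_eq_div, div_le_one (by positivity)]; nlinarith
  linarith

theorem betaCoeff_abs_le {H : Type*} [NormedAddCommGroup H] [InnerProductSpace ℝ H]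
    {n C : ℕ} (Yp : Fin n → Finset (Fin C))
    (hpos : ∀ i, (Yp i).Nonempty) (hneg : ∀ i, ((Yp i)ᶜ).Nonempty)
    (x : Fin n → Fin C → H) (W : Fin C → H) (i : Fin n) (c : Fin C) :
    |betaCoeff Yp x W i c| ≤ 2 := by
  classical
  have ha : (1 : ℝ) ≤ ((Yp i).card : ℝ) := by exact_mod_cast (hpos i).card_pos
  have hb : (1 : ℝ) ≤ (((Yp i)ᶜ).card : ℝ) := by exact_mod_cast (hneg i).card_pos
  have ind : ∀ (P : Prop) [Decidable P], (0 : ℝ) ≤ (if P then 1 else 0) ∧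
      (if P then (1 : ℝ) else 0) ≤ 1 := by
    intro P _; split_ifs <;> norm_num
  unfold betaCoeff
  by_cases hc : c ∈ Yp i
  · have hc' : c ∉ (Yp i)ᶜ := by simpa using hc
    have hs := sum_ind_bound ((Yp i)ᶜ) (fun q => ⟪W c, x i c⟫ ≤ 2 + ⟪W q, x i q⟫)
    have he := ind (⟪W c, x i c⟫ ≤ 1)
    have := coef_bound _ _ _ _ hb ha hs.1 hs.2 he.1 he.2
    rw [mul_comm (((Yp i)ᶜ).card : ℝ)] at this
    rw [if_pos hc, if_neg hc', abs_le]
    constructor <;> linarith [this.1, this.2]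
  · have hc' : c ∈ (Yp i)ᶜ := by simpa using hc
    have hs := sum_ind_bound (Yp i) (fun p => ⟪W p, x i p⟫ ≤ 2 + ⟪W c, x i c⟫)
    have he := ind ((-1 : ℝ) ≤ ⟪W c, x i c⟫)
    have := coef_bound _ _ _ _ ha hb hs.1 hs.2 he.1 he.2
    rw [if_neg hc, if_pos hc', abs_le]
    constructor <;> linarith [this.1, this.2]

/-- If all feature vectors have norm at most `K`, then the non-regularization
part of the subgradient satisfies `‖v_c(W)‖ ≤ 2 K`. -/
theorem stmt_4 {H : Type*} [NormedAddCommGroup H] [InnerProductSpace ℝ H]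
    (n C : ℕ) (hn : 0 < n) (hC : 0 < C)
    (Yp : Fin n → Finset (Fin C))
    (hpos : ∀ i, (Yp i).Nonempty) (hneg : ∀ i, ((Yp i)ᶜ).Nonempty)
    (x : Fin n → Fin C → H)
    (K : ℝ) (hK : 0 ≤ K) (hx : ∀ i c, ‖x i c‖ ≤ K) :
    ∀ (W : Fin C → H) (c : Fin C), ‖vPart Yp x W c‖ ≤ 2 * K := by
  intro W c
  have hn' : (0 : ℝ) < n := by exact_mod_cast hn
  have h : ‖∑ i, betaCoeff Yp x W i c • x i c‖ ≤ ∑ _i : Fin n, 2 * K := by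
    refine norm_sum_le_of_le _ fun i _ => ?_
    rw [norm_smul, Real.norm_eq_abs]
    exact mul_le_mul (betaCoeff_abs_le Yp hpos hneg x W i c) (hx i c) (norm_nonneg _) (by norm_num)
  rw [Finset.sum_const, Finset.card_univ, Fintype.card_fin, nsmul_eq_mul] at h
  unfold vPart
  rw [norm_smul, Real.norm_of_nonneg (by positivity), one_div_mul_eq_div, div_le_iff₀ hn']
  linarith
end

section
/- Suppose K ≥ 0 and ‖x_{i,c}‖ ≤ K for all i, c, and define iterates W_1 = 0 ∈ H^C and W_{t+1} = W_t − (1/(λt)) ∇(W_t) for t ≥ 1, where ∇(W) = (λ w_1 + v_1(W), …, λ w_C + v_C(W)). Then every iterate satisfies ‖w_t^c‖ ≤ 2K/λ for all t ≥ 1 and c ∈ {1,…,C}, and consequently Σ_{c=1}^C ‖∇_c(W_t)‖² ≤ 16 C K² for all t ≥ 1. -/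
open scoped RealInnerProductSpace
open Finset

/-- The explicit subgradient `∇(W)` of `L` at `W`, with components `λ w_c + v_c(W)`. -/
noncomputable def gradL {H : Type*} [NormedAddCommGroup H] [InnerProductSpace ℝ H]
    {n C : ℕ} (lam : ℝ) (Yp : Fin n → Finset (Fin C)) (x : Fin n → Fin C → H)
    (W : Fin C → H) : Fin C → H :=
  fun c => lam • W c + vPart Yp x W c

lemma aux_sum_bounds {α : Type*} (s : Finset α) (P : α → Prop) [DecidablePred P] :
    0 ≤ ∑ p ∈ s, (if P p then (1 : ℝ) else 0) ∧
      ∑ p ∈ s, (if P p then (1 : ℝ) else 0) ≤ s.card := by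
  constructor
  · exact Finset.sum_nonneg fun p _ => by split_ifs <;> norm_num
  · calc ∑ p ∈ s, (if P p then (1 : ℝ) else 0) ≤ ∑ p ∈ s, (1 : ℝ) :=
          Finset.sum_le_sum fun p _ => by split_ifs <;> norm_num
      _ = s.card := by simp

lemma aux_arith (p q a S : ℝ) (hp : 1 ≤ p) (hq : 1 ≤ q) (ha0 : 0 ≤ a) (ha1 : a ≤ 1)
    (hS0 : 0 ≤ S) (hS : S ≤ q) :
    0 ≤ 1 / p ^ 2 * a + 1 / (p * q) * S ∧ 1 / p ^ 2 * a + 1 / (p * q) * S ≤ 2 := by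
  have hp0 : 0 < p := by linarith
  have hq0 : 0 < q := by linarith
  refine ⟨by positivity, ?_⟩
  have h1 : 1 / p ^ 2 ≤ 1 := by
    rw [div_le_one (by positivity)]; nlinarith
  have h2 : 1 / p ^ 2 * a ≤ 1 := mul_le_one₀ h1 ha0 ha1
  have h3 : 1 / (p * q) * S ≤ 1 := by
    rw [one_div_mul_eq_div, div_le_one (by positivity)]; nlinarith
  linarith

lemma aux_beta {H : Type*} [NormedAddCommGroup H] [InnerProductSpace ℝ H]
    {n C : ℕ} (Yp : Fin n → Finset (Fin C)) (x : Fin n → Fin C → H)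
    (hpos : ∀ i, (Yp i).Nonempty) (hneg : ∀ i, ((Yp i)ᶜ).Nonempty)
    (W : Fin C → H) (i : Fin n) (c : Fin C) : |betaCoeff Yp x W i c| ≤ 2 := by
  classical
  have hp : (1 : ℝ) ≤ (Yp i).card := by exact_mod_cast (hpos i).card_pos
  have hq : (1 : ℝ) ≤ ((Yp i)ᶜ).card := by exact_mod_cast (hneg i).card_pos
  unfold betaCoeff
  generalize hpe : ((Yp i).card : ℝ) = p at *
  generalize hqe : (((Yp i)ᶜ).card : ℝ) = q at *
  by_cases hc : c ∈ Yp i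
  · have hc' : c ∉ (Yp i)ᶜ := by simpa using hc
    obtain ⟨s0, s1⟩ := aux_sum_bounds (Yp i)ᶜ (fun q => ⟪W c, x i c⟫ ≤ 2 + ⟪W q, x i q⟫)
    rw [hqe] at s1
    have := aux_arith p q (if ⟪W c, x i c⟫ ≤ 1 then 1 else 0) _ hp hq
      (by split_ifs <;> norm_num) (by split_ifs <;> norm_num) s0 s1
    simp only [if_pos hc, if_neg hc']
    rw [abs_le]
    constructor <;> linarith [this.1, this.2]
  · have hc' : c ∈ (Yp i)ᶜ := by simpa using hc
    obtain ⟨s0, s1⟩ := aux_sum_bounds (Yp i) (fun p => ⟪W p, x i p⟫ ≤ 2 + ⟪W c, x i c⟫)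
    rw [hpe] at s1
    have := aux_arith q p (if (-1 : ℝ) ≤ ⟪W c, x i c⟫ then 1 else 0) _ hq hp
      (by split_ifs <;> norm_num) (by split_ifs <;> norm_num) s0 s1
    rw [mul_comm q p] at this
    simp only [if_neg hc, if_pos hc']
    rw [abs_le]
    constructor <;> linarith [this.1, this.2]

lemma aux_v {H : Type*} [NormedAddCommGroup H] [InnerProductSpace ℝ H]
    {n C : ℕ} (hn : 0 < n) (Yp : Fin n → Finset (Fin C)) (x : Fin n → Fin C → H)
    (hpos : ∀ i, (Yp i).Nonempty) (hneg : ∀ i, ((Yp i)ᶜ).Nonempty)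
    (K : ℝ) (hx : ∀ i c, ‖x i c‖ ≤ K)
    (W : Fin C → H) (c : Fin C) : ‖vPart Yp x W c‖ ≤ 2 * K := by
  have hn' : (0 : ℝ) < n := by exact_mod_cast hn
  unfold vPart
  rw [norm_smul, Real.norm_of_nonneg (by positivity), one_div_mul_eq_div, div_le_iff₀ hn']
  calc _ ≤ ∑ i, ‖betaCoeff Yp x W i c • x i c‖ := norm_sum_le _ _
    _ ≤ ∑ i : Fin n, 2 * K := by
        refine Finset.sum_le_sum fun i _ => ?_
        rw [norm_smul, Real.norm_eq_abs]
        exact mul_le_mul (aux_beta Yp x hpos hneg W i c) (hx i c) (norm_nonneg _) (by norm_num)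
    _ = _ := by simp; ring

/-- Along the subgradient iterates starting from `0`, every weight satisfies
`‖w_t^c‖ ≤ 2K/λ`, and hence `Σ_c ‖∇_c(W_t)‖² ≤ 16 C K²`. -/
theorem stmt_11 {H : Type*} [NormedAddCommGroup H] [InnerProductSpace ℝ H]
    (n C : ℕ) (hn : 0 < n) (hC : 0 < C)
    (lam : ℝ) (hlam : 0 < lam)
    (Yp : Fin n → Finset (Fin C))
    (hpos : ∀ i, (Yp i).Nonempty) (hneg : ∀ i, ((Yp i)ᶜ).Nonempty)
    (x : Fin n → Fin C → H)
    (K : ℝ) (hK : 0 ≤ K) (hx : ∀ i c, ‖x i c‖ ≤ K)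
    (Wseq : ℕ → Fin C → H)
    (h1 : Wseq 1 = 0)
    (hrec : ∀ t, 1 ≤ t →
      Wseq (t + 1) = Wseq t - (1 / (lam * (t : ℝ))) • gradL lam Yp x (Wseq t)) :
    (∀ t, 1 ≤ t → ∀ c, ‖Wseq t c‖ ≤ 2 * K / lam) ∧
      ∀ t, 1 ≤ t → ∑ c, ‖gradL lam Yp x (Wseq t) c‖ ^ 2 ≤ 16 * C * K ^ 2 := by
  have hv := aux_v hn Yp x hpos hneg K hx
  have key : ∀ t, 1 ≤ t → ∀ c, ‖Wseq t c‖ ≤ 2 * K / lam := by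
    intro t ht
    induction t, ht using Nat.le_induction with
    | base => intro c; rw [h1]; simp; positivity
    | succ t ht ih =>
      intro c
      have ht' : (1 : ℝ) ≤ t := by exact_mod_cast ht
      have ht0 : (0 : ℝ) < t := by linarith
      have e : Wseq (t + 1) c
          = (1 - 1 / (t : ℝ)) • Wseq t c - (1 / (lam * (t : ℝ))) • vPart Yp x (Wseq t) c := by
        rw [hrec t ht]
        simp only [Pi.sub_apply, Pi.smul_apply, gradL, smul_add, smul_smul, sub_smul, one_smul]
        have : 1 / (lam * (t : ℝ)) * lam = 1 / t := by field_simp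
        rw [this]; abel
      have h0 : 0 ≤ 1 - 1 / (t : ℝ) := by
        rw [sub_nonneg, div_le_one ht0]; exact ht'
      rw [e]
      calc _ ≤ _ := norm_sub_le _ _
        _ = (1 - 1 / (t : ℝ)) * ‖Wseq t c‖
            + (1 / (lam * (t : ℝ))) * ‖vPart Yp x (Wseq t) c‖ := by
          rw [norm_smul, norm_smul, Real.norm_of_nonneg h0,
            Real.norm_of_nonneg (by positivity)]
        _ ≤ (1 - 1 / (t : ℝ)) * (2 * K / lam) + (1 / (lam * (t : ℝ))) * (2 * K) :=
          add_le_add (mul_le_mul_of_nonneg_left (ih c) h0)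
            (mul_le_mul_of_nonneg_left (hv _ c) (by positivity))
        _ = 2 * K / lam := by field_simp; ring
  refine ⟨key, fun t ht => ?_⟩
  have hg : ∀ c, ‖gradL lam Yp x (Wseq t) c‖ ^ 2 ≤ 16 * K ^ 2 := by
    intro c
    have h2 : ‖gradL lam Yp x (Wseq t) c‖ ≤ 4 * K := by
      have h3 := norm_add_le (lam • Wseq t c) (vPart Yp x (Wseq t) c)
      rw [norm_smul, Real.norm_of_nonneg hlam.le] at h3
      have h4 := key t ht c
      rw [le_div_iff₀ hlam] at h4
      have h5 := hv (Wseq t) c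
      unfold gradL
      linarith
    have := pow_le_pow_left₀ (norm_nonneg _) h2 2
    linarith
  calc _ ≤ ∑ c : Fin C, 16 * K ^ 2 := Finset.sum_le_sum fun c _ => hg c
    _ = _ := by simp; ring
end
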